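/- Suppose κ is a cardinal, λ ≥ κ and A is a set of ordinals. If κ is both λ-strong for A and λ-strongly compact, then κ is λ-strongly compact for A. -/

import Mathlib

/-!
A framework for formalizing large-cardinal notions from
"Woodin for strong compactness cardinals" over the Mathlib model `ZFSet`
of ZFC.  The ambient set-theoretic universe `V` is the type `ZFSet`;
classes are sets `Set ZFSet`; everything is relativised to a "universe
class" `W : Set ZFSet` (the ambient universe being `W = Set.univ`), so
that the same definitions can also be interpreted inside transitive set
models of ZFC (used to express the forcing/consistency results).
-/

namespace WSC

/-! ### First-order formulas in the language of set theory -/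

/-- First-order formulas in the language `{∈}`, with `n` free (de Bruijn) variables. -/
inductive Fml : ℕ → Type where
  | mem {n} : Fin n → Fin n → Fml n
  | eq  {n} : Fin n → Fin n → Fml n
  | not {n} : Fml n → Fml n
  | and {n} : Fml n → Fml n → Fml n
  | ex  {n} : Fml (n + 1) → Fml n

namespace Fml

/-- Realization of a formula over the class `C`, with all quantifiers relativised to `C`. -/
def Realize (C : Set ZFSet) : ∀ {n}, Fml n → (Fin n → ZFSet) → Prop
  | _, .mem i j, v => v i ∈ v j
  | _, .eq i j, v => v i = v j
  | _, .not φ, v => ¬ Realize C φ v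
  | _, .and φ ψ, v => Realize C φ v ∧ Realize C ψ v
  | _, .ex φ, v => ∃ x ∈ C, Realize C φ (Fin.snoc v x)

def or {n} (φ ψ : Fml n) : Fml n := .not (.and (.not φ) (.not ψ))
def imp {n} (φ ψ : Fml n) : Fml n := Fml.or (.not φ) ψ
def iff {n} (φ ψ : Fml n) : Fml n := .and (imp φ ψ) (imp ψ φ)
def all {n} (φ : Fml (n + 1)) : Fml n := .not (.ex (.not φ))

/-- Universal closure. -/
def alls : ∀ {n}, Fml n → Fml 0
  | 0, φ => φ
  | _ + 1, φ => alls (all φ)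

/-- Renaming of variables. -/
def rename : ∀ {n m}, (Fin n → Fin m) → Fml n → Fml m
  | _, _, f, .mem i j => .mem (f i) (f j)
  | _, _, f, .eq i j => .eq (f i) (f j)
  | _, _, f, .not φ => .not (rename f φ)
  | _, _, f, .and φ ψ => .and (rename f φ) (rename f ψ)
  | _, _, f, .ex φ => .ex (rename (Fin.snoc (fun i => (f i).castSucc) (Fin.last _)) φ)

end Fml

/-- A sentence `φ` holds in the class `C`. -/
def Sat (C : Set ZFSet) (φ : Fml 0) : Prop := Fml.Realize C φ (fun i => i.elim0)

/-! ### The ZFC axioms -/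

def extAx : Fml 0 :=
  Fml.all (Fml.all (Fml.imp (Fml.all (Fml.iff (.mem 2 0) (.mem 2 1))) (.eq 0 1)))

def pairAx : Fml 0 := Fml.all (Fml.all (Fml.ex (Fml.and (.mem 0 2) (.mem 1 2))))

def unionAx : Fml 0 :=
  Fml.all (Fml.ex (Fml.all (Fml.all
    (Fml.imp (Fml.and (.mem 2 3) (.mem 3 0)) (.mem 2 1)))))

def powerAx : Fml 0 :=
  Fml.all (Fml.ex (Fml.all
    (Fml.imp (Fml.all (Fml.imp (.mem 3 2) (.mem 3 0))) (.mem 2 1))))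

def infAx : Fml 0 :=
  Fml.ex (Fml.and
    (Fml.ex (Fml.and (.mem 1 0) (Fml.all (Fml.not (.mem 2 1)))))
    (Fml.all (Fml.imp (.mem 1 0)
      (Fml.ex (Fml.and (.mem 2 0)
        (Fml.all (Fml.iff (.mem 3 2) (Fml.or (.mem 3 1) (.eq 3 1)))))))))

def foundAx : Fml 0 :=
  Fml.all (Fml.imp (Fml.ex (.mem 1 0))
    (Fml.ex (Fml.and (.mem 1 0) (Fml.all (Fml.imp (.mem 2 1) (Fml.not (.mem 2 0)))))))

def choiceAx : Fml 0 :=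
  Fml.all (Fml.imp
    (Fml.and
      (Fml.all (Fml.imp (.mem 1 0) (Fml.ex (.mem 2 1))))
      (Fml.all (Fml.all (Fml.imp
        (Fml.and (.mem 1 0) (Fml.and (.mem 2 0) (Fml.ex (Fml.and (.mem 3 1) (.mem 3 2)))))
        (.eq 1 2)))))
    (Fml.ex (Fml.all (Fml.imp (.mem 2 0)
      (Fml.ex (Fml.and (Fml.and (.mem 3 2) (.mem 3 1))
        (Fml.all (Fml.imp (Fml.and (.mem 4 2) (.mem 4 1)) (.eq 4 3)))))))))

/-- An instance of the separation schema, for a formula `φ` with parameters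
`0, …, n-1` and distinguished variable `n`. -/
def sepAx (n : ℕ) (φ : Fml (n + 1)) : Fml 0 :=
  Fml.alls ((Fml.ex (Fml.all (Fml.iff
    (Fml.mem (⟨n + 2, by omega⟩ : Fin (n + 3)) ⟨n + 1, by omega⟩)
    (Fml.and (Fml.mem (⟨n + 2, by omega⟩ : Fin (n + 3)) ⟨n, by omega⟩)
      (Fml.rename (fun i => if h : (i : ℕ) < n then (⟨i, by omega⟩ : Fin (n + 3))
        else ⟨n + 2, by omega⟩) φ))))) : Fml (n + 1))

/-- An instance of the collection schema, for a formula `φ` with parameters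
`0, …, n-1` and distinguished variables `n` (input) and `n+1` (output). -/
def collAx (n : ℕ) (φ : Fml (n + 2)) : Fml 0 :=
  let φ' : Fml (n + 4) := Fml.rename (fun i => if h : (i : ℕ) < n then (⟨i, by omega⟩ : Fin (n + 4))
    else ⟨(i : ℕ) + 2, by have := i.isLt; omega⟩) φ
  Fml.alls ((Fml.ex (Fml.all
    (Fml.imp (Fml.mem (⟨n + 2, by omega⟩ : Fin (n + 3)) ⟨n, by omega⟩)
      (Fml.imp (Fml.ex φ')
        (Fml.ex (Fml.and (Fml.mem (⟨n + 3, by omega⟩ : Fin (n + 4)) ⟨n + 1, by omega⟩) φ')))))) : Fml (n + 1))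

/-- The ZFC axioms. -/
def ZFCax : Set (Fml 0) :=
  {extAx, pairAx, unionAx, powerAx, infAx, foundAx, choiceAx} ∪
    (⋃ n, Set.range (sepAx n)) ∪ (⋃ n, Set.range (collAx n))

/-- A transitive set model of ZFC. -/
def IsZFModel (m : ZFSet) : Prop := m.IsTransitive ∧ ∀ φ ∈ ZFCax, Sat m.toSet φ

/-- A countable transitive model of ZFC. -/
def IsCtm (m : ZFSet) : Prop := IsZFModel m ∧ m.toSet.Countable

/-! ### Basic set-theoretic notions -/

/-- `x` is a (von Neumann) ordinal: a transitive set of transitive sets. -/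
def IsOrd (x : ZFSet) : Prop := x.IsTransitive ∧ ∀ y ∈ x, ZFSet.IsTransitive y

/-- `x ≤ y` for ordinals. -/
def oLe (x y : ZFSet) : Prop := x ∈ y ∨ x = y

/-- `f` is a function with domain `d` (coded as a set of Kuratowski pairs). -/
def IsFuncOn (d f : ZFSet) : Prop :=
  (∀ p ∈ f, ∃ a b : ZFSet, a ∈ d ∧ p = a.pair b) ∧ ∀ a ∈ d, ∃! b : ZFSet, a.pair b ∈ f

/-- All values of the (partial) function `f` lie in `b`. -/
def MapsInto (f b : ZFSet) : Prop := ∀ x y : ZFSet, x.pair y ∈ f → y ∈ b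

/-- The function `f` is injective. -/
def InjFun (f : ZFSet) : Prop := ∀ x x' y : ZFSet, x.pair y ∈ f → x'.pair y ∈ f → x = x'

/-- `|a| ≤ |b|`, witnessed by an injection belonging to the universe class `W`. -/
def SetLeIn (W : Set ZFSet) (a b : ZFSet) : Prop :=
  ∃ f ∈ W, IsFuncOn a f ∧ MapsInto f b ∧ InjFun f

/-- `κ` is a cardinal (relative to the universe class `W`). -/
def IsCardIn (W : Set ZFSet) (κ : ZFSet) : Prop :=
  IsOrd κ ∧ ∀ α ∈ κ, ¬ SetLeIn W κ α

/-- `M` is a transitive class. -/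
def TransClass (M : Set ZFSet) : Prop := ∀ x ∈ M, ∀ y : ZFSet, y ∈ x → y ∈ M

/-- An elementary embedding `j : (W, ∈) → (M, ∈)` between two classes. -/
structure ElemEmb (W M : Set ZFSet) where
  toFun : ZFSet → ZFSet
  maps : ∀ x ∈ W, toFun x ∈ M
  elem : ∀ {n : ℕ} (φ : Fml n) (v : Fin n → ZFSet), (∀ i, v i ∈ W) →
    (Fml.Realize W φ v ↔ Fml.Realize M φ (fun i => toFun (v i)))

/-- `κ` is the critical point of `j`: the least ordinal moved. -/
def IsCrit {W M : Set ZFSet} (j : ElemEmb W M) (κ : ZFSet) : Prop :=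
  IsOrd κ ∧ j.toFun κ ≠ κ ∧ ∀ α ∈ κ, j.toFun α = α

/-! ### The rank hierarchy -/

/-- `x ∈ V_lam`. -/
def VMem (lam x : ZFSet) : Prop := x.rank < lam.rank

/-- `V_lam ⊆ M` (with `V_lam` computed in the universe class `W`). -/
def VInclIn (W M : Set ZFSet) (lam : ZFSet) : Prop := ∀ x ∈ W, VMem lam x → x ∈ M

/-- `A ⊆ V_δ`. -/
def SubV (A δ : ZFSet) : Prop := ∀ x ∈ A, VMem δ x

/-- `A ∩ V_lam = B ∩ V_lam`. -/
def AgreeBelowIn (W : Set ZFSet) (lam A B : ZFSet) : Prop :=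
  ∀ x ∈ W, VMem lam x → (x ∈ A ↔ x ∈ B)

/-- `A ∩ lam = B ∩ lam` (for sets of ordinals). -/
def AgreeMem (lam A B : ZFSet) : Prop := ∀ ξ ∈ lam, (ξ ∈ A ↔ ξ ∈ B)

/-! ### Covering properties -/

/-- `M ⊨ |s| < t`: in `M` there is an injection of `s` into some ordinal `β ∈ t`. -/
def CardLtIn (M : Set ZFSet) (s t : ZFSet) : Prop :=
  ∃ β f : ZFSet, β ∈ t ∧ f ∈ M ∧ IsFuncOn s f ∧ MapsInto f β ∧ InjFun f

/-- `j` satisfies the weak `lam`-covering property (with target class `M`):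
there is `s ∈ M` with `j '' lam ⊆ s` and `M ⊨ |s| < j κ`. -/
def WCovers (M : Set ZFSet) (j : ZFSet → ZFSet) (κ lam : ZFSet) : Prop :=
  ∃ s ∈ M, (∀ α ∈ lam, j α ∈ s) ∧ CardLtIn M s (j κ)

/-- `j` satisfies the (full) `lam`-covering property: every `X ∈ W` with
`X ⊆ M` and `|X| ≤ lam` is covered by some `s ∈ M` with `M ⊨ |s| < j κ`. -/
def CoversIn (W M : Set ZFSet) (j : ZFSet → ZFSet) (κ lam : ZFSet) : Prop :=
  ∀ X ∈ W, X.toSet ⊆ M → SetLeIn W X lam → ∃ s ∈ M, X ⊆ s ∧ CardLtIn M s (j κ)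

/-! ### Strongness -/

/-- `κ` is `lam`-strong. -/
def LamStrongIn (W : Set ZFSet) (κ lam : ZFSet) : Prop :=
  ∃ M : Set ZFSet, M ⊆ W ∧ TransClass M ∧ ∃ j : ElemEmb W M,
    IsCrit j κ ∧ lam ∈ j.toFun κ ∧ VInclIn W M lam

/-- `κ` is `lam`-strong for `A`. -/
def LamStrongForIn (W : Set ZFSet) (κ lam A : ZFSet) : Prop :=
  ∃ M : Set ZFSet, M ⊆ W ∧ TransClass M ∧ ∃ j : ElemEmb W M,
    IsCrit j κ ∧ lam ∈ j.toFun κ ∧ VInclIn W M lam ∧ AgreeBelowIn W lam A (j.toFun A)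

/-- `κ` is `<δ`-strong. -/
def LtStrongIn (W : Set ZFSet) (κ δ : ZFSet) : Prop :=
  ∀ lam : ZFSet, oLe κ lam → lam ∈ δ → LamStrongIn W κ lam

/-- `κ` is `<δ`-strong for `A`. -/
def LtStrongForIn (W : Set ZFSet) (κ δ A : ZFSet) : Prop :=
  ∀ lam : ZFSet, oLe κ lam → lam ∈ δ → LamStrongForIn W κ lam A

/-! ### Strong compactness -/

/-- `κ` is `lam`-strongly compact (there is an embedding with critical point `κ`,
`j κ > lam`, satisfying the weak `lam`-covering property). -/
def LamSCIn (W : Set ZFSet) (κ lam : ZFSet) : Prop :=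
  ∃ M : Set ZFSet, M ⊆ W ∧ TransClass M ∧ ∃ j : ElemEmb W M,
    IsCrit j κ ∧ lam ∈ j.toFun κ ∧ WCovers M j.toFun κ lam

/-- `κ` is `lam`-strongly compact for the set of ordinals `A`: there is a
`lam`-strong compactness embedding `j` (one with the full `lam`-covering
property) with critical point `κ` and `A ∩ lam = j A ∩ lam`. -/
def LamSCForIn (W : Set ZFSet) (κ lam A : ZFSet) : Prop :=
  ∃ M : Set ZFSet, M ⊆ W ∧ TransClass M ∧ ∃ j : ElemEmb W M,
    IsCrit j κ ∧ lam ∈ j.toFun κ ∧ CoversIn W M j.toFun κ lam ∧ AgreeMem lam A (j.toFun A)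

/-- `κ` is `<δ`-strongly compact. -/
def LtSCIn (W : Set ZFSet) (κ δ : ZFSet) : Prop :=
  ∀ lam : ZFSet, oLe κ lam → lam ∈ δ → LamSCIn W κ lam

/-- `κ` is `<δ`-strongly compact for `A`. -/
def LtSCForIn (W : Set ZFSet) (κ δ A : ZFSet) : Prop :=
  ∀ lam : ZFSet, oLe κ lam → lam ∈ δ → LamSCForIn W κ lam A

/-! ### Supercompactness -/

/-- `M` is closed under `lam`-sequences (from the universe class `W`). -/
def SeqClosedIn (W M : Set ZFSet) (lam : ZFSet) : Prop :=
  ∀ f ∈ W, IsFuncOn lam f → (∀ x y : ZFSet, x.pair y ∈ f → y ∈ M) → f ∈ M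

/-- `κ` is `lam`-supercompact. -/
def LamSupercompactIn (W : Set ZFSet) (κ lam : ZFSet) : Prop :=
  ∃ M : Set ZFSet, M ⊆ W ∧ TransClass M ∧ ∃ j : ElemEmb W M,
    IsCrit j κ ∧ lam ∈ j.toFun κ ∧ SeqClosedIn W M lam

/-- `κ` is `lam`-supercompact for `A`. -/
def LamSupercompactForIn (W : Set ZFSet) (κ lam A : ZFSet) : Prop :=
  ∃ M : Set ZFSet, M ⊆ W ∧ TransClass M ∧ ∃ j : ElemEmb W M,
    IsCrit j κ ∧ lam ∈ j.toFun κ ∧ SeqClosedIn W M lam ∧ AgreeBelowIn W lam A (j.toFun A)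

/-- `κ` is `<δ`-supercompact. -/
def LtSupercompactIn (W : Set ZFSet) (κ δ : ZFSet) : Prop :=
  ∀ lam : ZFSet, oLe κ lam → lam ∈ δ → LamSupercompactIn W κ lam

/-- `κ` is `<δ`-supercompact for `A`. -/
def LtSupercompactForIn (W : Set ZFSet) (κ δ A : ZFSet) : Prop :=
  ∀ lam : ZFSet, oLe κ lam → lam ∈ δ → LamSupercompactForIn W κ lam A

/-! ### The global large-cardinal notions -/

/-- `δ` is a Woodin cardinal. -/
def WoodinIn (W : Set ZFSet) (δ : ZFSet) : Prop :=
  IsCardIn W δ ∧ ∀ A ∈ W, SubV A δ → ∃ κ, κ ∈ δ ∧ LtStrongForIn W κ δ A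

/-- `δ` is a Woodin for strong compactness cardinal. -/
def WoodinSCIn (W : Set ZFSet) (δ : ZFSet) : Prop :=
  IsCardIn W δ ∧ ∀ A ∈ W, A ⊆ δ → ∃ κ, κ ∈ δ ∧ LtSCForIn W κ δ A

/-- `δ` is a Vopěnka cardinal. -/
def VopenkaIn (W : Set ZFSet) (δ : ZFSet) : Prop :=
  IsCardIn W δ ∧ ∀ A ∈ W, SubV A δ → ∃ κ, κ ∈ δ ∧ LtSupercompactForIn W κ δ A

/-- `δ` is Woodin and a limit of `<δ`-supercompact cardinals. -/
def WoodinLimSupercompactIn (W : Set ZFSet) (δ : ZFSet) : Prop :=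
  WoodinIn W δ ∧ ∀ α ∈ δ, ∃ κ : ZFSet, α ∈ κ ∧ κ ∈ δ ∧ LtSupercompactIn W κ δ

/-! ### Inaccessibility -/

/-- `δ` is a regular ordinal: the range of any function from a smaller
ordinal into `δ` is bounded. -/
def RegularIn (W : Set ZFSet) (δ : ZFSet) : Prop :=
  IsOrd δ ∧ ∀ α ∈ δ, ∀ f ∈ W, IsFuncOn α f → MapsInto f δ →
    ∃ β ∈ δ, ∀ x y : ZFSet, x.pair y ∈ f → y ∈ β

/-- The power set of `x` relative to `W`. -/
def powersetIn (W : Set ZFSet) (x : ZFSet) : ZFSet := ZFSet.sep (fun z => z ∈ W) x.powerset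

/-- `δ` is a strong limit cardinal. -/
def StrongLimitIn (W : Set ZFSet) (δ : ZFSet) : Prop :=
  IsCardIn W δ ∧ ∀ α ∈ δ, ∃ β ∈ δ, SetLeIn W (powersetIn W α) β

/-- `δ` is inaccessible: an uncountable regular strong limit cardinal. -/
def InaccessibleIn (W : Set ZFSet) (δ : ZFSet) : Prop :=
  ZFSet.omega ∈ δ ∧ IsCardIn W δ ∧ RegularIn W δ ∧ StrongLimitIn W δ

/-! ### Ultrafilters and measurability -/

/-- Relative complement `a \ b`. -/
def zdiff (a b : ZFSet) : ZFSet := ZFSet.sep (fun x => x ∉ b) a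

/-- Intersection `a ∩ b`. -/
def zinter (a b : ZFSet) : ZFSet := ZFSet.sep (fun x => x ∈ b) a

/-- `U` is a nonprincipal `α`-complete ultrafilter on `α`. -/
def IsUfOnIn (W : Set ZFSet) (α U : ZFSet) : Prop :=
  (∀ x ∈ U, x ⊆ α) ∧ α ∈ U ∧ (∅ : ZFSet) ∉ U ∧
  (∀ x ∈ U, ∀ y : ZFSet, y ∈ W → y ⊆ α → x ⊆ y → y ∈ U) ∧
  (∀ x ∈ W, x ⊆ α → (x ∈ U ∨ zdiff α x ∈ U)) ∧
  (∀ β ∈ α, ∀ g ∈ W, IsFuncOn β g → MapsInto g U →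
    ZFSet.sep (fun ξ => ∀ p q : ZFSet, p.pair q ∈ g → ξ ∈ q) α ∈ U) ∧
  (∀ ξ ∈ α, ZFSet.sep (fun x => x = ξ) α ∉ U)

/-- `U` is a normal ultrafilter on `α`: a nonprincipal `α`-complete
ultrafilter closed under diagonal intersections. -/
def IsNormalUfOnIn (W : Set ZFSet) (α U : ZFSet) : Prop :=
  IsUfOnIn W α U ∧
    ∀ g ∈ W, IsFuncOn α g → MapsInto g U →
      ZFSet.sep (fun ξ => ∀ p q : ZFSet, p.pair q ∈ g → p ∈ ξ → ξ ∈ q) α ∈ U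

/-- `α` is a measurable cardinal. -/
def MeasurableIn (W : Set ZFSet) (α : ZFSet) : Prop := ∃ U ∈ W, IsUfOnIn W α U

/-! ### Functions `f : δ → δ` and closure points -/

/-- `f` codes a function from `δ` to `δ`. -/
def FuncSelf (δ f : ZFSet) : Prop := IsFuncOn δ f ∧ MapsInto f δ

/-- `κ` is a closure point of `f`, i.e. `f '' κ ⊆ κ`. -/
def ClosurePt (f κ : ZFSet) : Prop := ∀ x y : ZFSet, x.pair y ∈ f → x ∈ κ → y ∈ κ

/-! ### GCH -/

/-- GCH: for every infinite cardinal `κ`, any family of subsets of `κ` has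
size at most `κ` or size at least that of the full power set of `κ`. -/
def GCHIn (W : Set ZFSet) : Prop :=
  ∀ κ ∈ W, IsCardIn W κ → oLe ZFSet.omega κ →
    ∀ X ∈ W, (∀ z ∈ X, z ⊆ κ) → (SetLeIn W X κ ∨ SetLeIn W (powersetIn W κ) X)

/-! ### Forcing -/

/-- `(P, R)` is a forcing notion (a preordered set, `x.pair y ∈ R` meaning
`x ≤ y`, i.e. `x` is stronger than `y`). -/
def IsPoset (P R : ZFSet) : Prop :=
  (∀ p ∈ P, p.pair p ∈ R) ∧
  (∀ p q r : ZFSet, p.pair q ∈ R → q.pair r ∈ R → p.pair r ∈ R) ∧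
  (∀ x y : ZFSet, x.pair y ∈ R → x ∈ P ∧ y ∈ P)

/-- `G` is an `m`-generic filter on the forcing notion `(P, R) ∈ m`. -/
def IsGenericFilter (m P R G : ZFSet) : Prop :=
  G ⊆ P ∧
  (∀ p ∈ G, ∀ q ∈ P, p.pair q ∈ R → q ∈ G) ∧
  (∀ p ∈ G, ∀ q ∈ G, ∃ r ∈ G, r.pair p ∈ R ∧ r.pair q ∈ R) ∧
  (∀ D ∈ m, (D ⊆ P ∧ ∀ p ∈ P, ∃ q ∈ D, q.pair p ∈ R) → ∃ q, q ∈ G ∧ q ∈ D)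

/-- `n = m[G]` : `n` is a transitive ZFC-model extending `m` and containing
`G`, and is the least such. -/
def IsGenericExt (m G n : ZFSet) : Prop :=
  IsZFModel n ∧ m ⊆ n ∧ G ∈ n ∧
    ∀ n' : ZFSet, IsZFModel n' → m ⊆ n' → G ∈ n' → n ⊆ n'

/-- `n` is a (set-)forcing extension of the transitive model `m`. -/
def IsForcingExt (m n : ZFSet) : Prop :=
  ∃ P R G : ZFSet, P ∈ m ∧ R ∈ m ∧ IsPoset P R ∧
    IsGenericFilter m P R G ∧ IsGenericExt m G n

/-! ### Ambient (full-universe) abbreviations -/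

abbrev LamStrong (κ lam : ZFSet) : Prop := LamStrongIn Set.univ κ lam
abbrev LamStrongFor (κ lam A : ZFSet) : Prop := LamStrongForIn Set.univ κ lam A
abbrev LtStrong (κ δ : ZFSet) : Prop := LtStrongIn Set.univ κ δ
abbrev LtStrongFor (κ δ A : ZFSet) : Prop := LtStrongForIn Set.univ κ δ A
abbrev LamSC (κ lam : ZFSet) : Prop := LamSCIn Set.univ κ lam
abbrev LamSCFor (κ lam A : ZFSet) : Prop := LamSCForIn Set.univ κ lam A
abbrev LtSC (κ δ : ZFSet) : Prop := LtSCIn Set.univ κ δ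
abbrev LtSCFor (κ δ A : ZFSet) : Prop := LtSCForIn Set.univ κ δ A
abbrev LamSupercompact (κ lam : ZFSet) : Prop := LamSupercompactIn Set.univ κ lam
abbrev LtSupercompact (κ δ : ZFSet) : Prop := LtSupercompactIn Set.univ κ δ
abbrev Woodin (δ : ZFSet) : Prop := WoodinIn Set.univ δ
abbrev WoodinSC (δ : ZFSet) : Prop := WoodinSCIn Set.univ δ
abbrev Vopenka (δ : ZFSet) : Prop := VopenkaIn Set.univ δ
abbrev IsCard (κ : ZFSet) : Prop := IsCardIn Set.univ κ
abbrev Inaccessible (δ : ZFSet) : Prop := InaccessibleIn Set.univ δ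
abbrev Covers (M : Set ZFSet) (j : ZFSet → ZFSet) (κ lam : ZFSet) : Prop :=
  CoversIn Set.univ M j κ lam
abbrev VIncl (M : Set ZFSet) (lam : ZFSet) : Prop := VInclIn Set.univ M lam
abbrev AgreeBelow (lam A B : ZFSet) : Prop := AgreeBelowIn Set.univ lam A B
abbrev SeqClosed (M : Set ZFSet) (lam : ZFSet) : Prop := SeqClosedIn Set.univ M lam

universe u
/-! ### Definable relations on transitive classes -/

/-- `R` is uniformly definable, over all transitive classes, by a first-order formula. -/
def Dfn {n : ℕ} (R : Set ZFSet.{u} → (Fin n → ZFSet.{u}) → Prop) : Prop :=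
  ∃ φ : Fml n, ∀ C, TransClass C → ∀ v, (∀ i, v i ∈ C) → (φ.Realize C v ↔ R C v)

theorem Fml.realize_rename (C : Set ZFSet.{u}) {n m : ℕ} (φ : Fml n) (f : Fin n → Fin m)
    (v : Fin m → ZFSet.{u}) :
    (φ.rename f).Realize C v ↔ φ.Realize C (fun i => v (f i)) := by
  induction φ generalizing m with
  | mem i j => rfl
  | eq i j => rfl
  | not φ ih => exact not_congr (ih f v)
  | and φ ψ ih₁ ih₂ => exact and_congr (ih₁ f v) (ih₂ f v)
  | ex φ ih =>
    refine exists_congr fun x => and_congr_right fun _ => ?_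
    rw [ih]
    refine iff_of_eq (congrArg _ (funext fun i => ?_))
    refine Fin.lastCases ?_ (fun i => ?_) i <;> simp

namespace Dfn

variable {n m : ℕ} {R S : Set ZFSet.{u} → (Fin n → ZFSet.{u}) → Prop}

theorem congr (hR : Dfn R)
    (h : ∀ C, TransClass C → ∀ v, (∀ i, v i ∈ C) → (R C v ↔ S C v)) : Dfn S :=
  let ⟨φ, hφ⟩ := hR
  ⟨φ, fun C hC v hv => (hφ C hC v hv).trans (h C hC v hv)⟩

theorem mem (i j : Fin n) : Dfn.{u} fun _ v => v i ∈ v j :=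
  ⟨.mem i j, fun _ _ _ _ => Iff.rfl⟩

theorem eq (i j : Fin n) : Dfn.{u} fun _ v => v i = v j :=
  ⟨.eq i j, fun _ _ _ _ => Iff.rfl⟩

theorem not (hR : Dfn R) : Dfn fun C v => ¬ R C v :=
  let ⟨φ, hφ⟩ := hR
  ⟨.not φ, fun C hC v hv => not_congr (hφ C hC v hv)⟩

theorem and (hR : Dfn R) (hS : Dfn S) : Dfn fun C v => R C v ∧ S C v :=
  let ⟨φ, hφ⟩ := hR
  let ⟨ψ, hψ⟩ := hS
  ⟨.and φ ψ, fun C hC v hv => and_congr (hφ C hC v hv) (hψ C hC v hv)⟩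

theorem or (hR : Dfn R) (hS : Dfn S) : Dfn fun C v => R C v ∨ S C v :=
  (hR.not.and hS.not).not.congr fun _ _ _ _ => by tauto

theorem imp (hR : Dfn R) (hS : Dfn S) : Dfn fun C v => R C v → S C v :=
  (hR.not.or hS).congr fun _ _ _ _ => by tauto

theorem iff (hR : Dfn R) (hS : Dfn S) : Dfn fun C v => (R C v ↔ S C v) :=
  ((hR.imp hS).and (hS.imp hR)).congr fun _ _ _ _ => by tauto

theorem ex {Q : Set ZFSet.{u} → (Fin n → ZFSet.{u}) → ZFSet.{u} → Prop}
    (h : Dfn fun C (w : Fin (n + 1) → ZFSet.{u}) => Q C (Fin.init w) (w (Fin.last n))) :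
    Dfn fun C v => ∃ x ∈ C, Q C v x := by
  obtain ⟨φ, hφ⟩ := h
  refine ⟨.ex φ, fun C hC v hv => exists_congr fun x => and_congr_right fun hx => ?_⟩
  rw [hφ C hC]
  · simp
  · intro i
    refine Fin.lastCases ?_ (fun i => ?_) i
    · simpa using hx
    · simpa using hv i

theorem all {Q : Set ZFSet.{u} → (Fin n → ZFSet.{u}) → ZFSet.{u} → Prop}
    (h : Dfn fun C (w : Fin (n + 1) → ZFSet.{u}) => Q C (Fin.init w) (w (Fin.last n))) :
    Dfn fun C v => ∀ x ∈ C, Q C v x :=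
  (ex (Q := fun C v x => ¬ Q C v x) h.not).not.congr fun _ _ _ _ => by push Not; rfl

theorem bex (i : Fin n) {Q : Set ZFSet.{u} → (Fin n → ZFSet.{u}) → ZFSet.{u} → Prop}
    (h : Dfn fun C (w : Fin (n + 1) → ZFSet.{u}) => Q C (Fin.init w) (w (Fin.last n))) :
    Dfn fun C v => ∃ x ∈ v i, Q C v x :=
  (ex (Q := fun C v x => x ∈ v i ∧ Q C v x)
    ((mem (Fin.last n) i.castSucc).and h)).congr fun _ hC _ hv =>
      ⟨fun ⟨x, _, h⟩ => ⟨x, h⟩, fun ⟨x, hx, h⟩ => ⟨x, hC _ (hv i) x hx, hx, h⟩⟩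

theorem ball (i : Fin n) {Q : Set ZFSet.{u} → (Fin n → ZFSet.{u}) → ZFSet.{u} → Prop}
    (h : Dfn fun C (w : Fin (n + 1) → ZFSet.{u}) => Q C (Fin.init w) (w (Fin.last n))) :
    Dfn fun C v => ∀ x ∈ v i, Q C v x :=
  (bex i (Q := fun C v x => ¬ Q C v x) h.not).not.congr fun _ _ _ _ => by push Not; rfl

theorem true : Dfn.{u} fun _ (_ : Fin n → ZFSet.{u}) => True :=
  (all (Q := fun _ _ x => x = x) (eq _ _)).congr fun _ _ _ _ => by simp

theorem forall_fin {Q : Fin m → Set ZFSet.{u} → (Fin n → ZFSet.{u}) → Prop}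
    (h : ∀ i, Dfn (Q i)) : Dfn fun C v => ∀ i, Q i C v := by
  induction m with
  | zero => exact true.congr fun _ _ _ _ => by simp
  | succ m ih =>
    exact ((h 0).and (ih fun i => h i.succ)).congr fun C _ v _ =>
      (Fin.forall_fin_succ (P := fun i => Q i C v)).symm

theorem forall_tuple {Q : Set ZFSet.{u} → (Fin n → ZFSet.{u}) → (Fin m → ZFSet.{u}) → Prop}
    (h : Dfn fun C (w : Fin (n + m) → ZFSet.{u}) =>
      Q C (fun i => w (Fin.castAdd m i)) fun i => w (Fin.natAdd n i)) :
    Dfn fun C v => ∀ w : Fin m → ZFSet.{u}, (∀ i, w i ∈ C) → Q C v w := by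
  induction m with
  | zero =>
    refine h.congr fun C _ v _ => ⟨fun h w _ => ?_, fun h => h _ (fun i => i.elim0)⟩
    rwa [show w = fun i => v (Fin.natAdd n i) from funext fun i => i.elim0]
  | succ m ih =>
    refine (ih (Q := fun C v w => ∀ x ∈ C, Q C v (Fin.snoc w x)) (all ?_)).congr
      fun C hC v hv => ⟨fun h w hw => ?_, fun h w hw x hx => h _ fun i => ?_⟩
    · refine h.congr fun C _ w _ => iff_of_eq (congrArg₂ _ rfl (funext fun i => ?_))
      refine Fin.lastCases ?_ (fun i => ?_) i
      · simp
      · simp only [Fin.snoc_castSucc]; rfl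
    · simpa using h (Fin.init w) (fun i => hw _) (w (Fin.last m)) (hw _)
    · refine Fin.lastCases ?_ (fun i => ?_) i
      · simpa using hx
      · simpa using hw i

theorem realize (φ : Fml m) (f : Fin m → Fin n) :
    Dfn.{u} fun C v => φ.Realize C fun i => v (f i) :=
  ⟨φ.rename f, fun C _ v _ => φ.realize_rename C f v⟩

theorem realize_of_mem (φ : Fml m) (y : Fin n) (f : Fin m → Fin n) :
    Dfn.{u} fun _ v => φ.Realize {x | x ∈ v y} fun i => v (f i) := by
  induction φ generalizing n with
  | mem i j => exact mem _ _
  | eq i j => exact eq _ _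
  | not φ ih => exact (ih y f).not
  | and φ ψ ih₁ ih₂ => exact (ih₁ y f).and (ih₂ y f)
  | ex φ ih =>
    refine bex y (Q := fun _ v x =>
      φ.Realize {z | z ∈ v y} (Fin.snoc (fun i => v (f i)) x)) ?_
    refine (ih y.castSucc (Fin.snoc (fun i => (f i).castSucc) (Fin.last _))).congr
      fun C _ w _ => iff_of_eq (congrArg _ (funext fun i => ?_))
    refine Fin.lastCases ?_ (fun i => ?_) i
    · simp
    · simp [Fin.init]

theorem eq_pair (p a b : Fin n) : Dfn.{u} fun _ v => v p = (v a).pair (v b) := by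
  have h : Dfn.{u} fun _ (v : Fin n → ZFSet.{u}) => ∃ s ∈ v p, ∃ t ∈ v p,
      (∀ z ∈ v p, z = s ∨ z = t) ∧ ((∀ z ∈ s, z = v a) ∧ v a ∈ s) ∧
      (∀ z ∈ t, z = v a ∨ z = v b) ∧ v a ∈ t ∧ v b ∈ t :=
    bex _ <| bex p.castSucc <| .and (ball p.castSucc.castSucc (.or (eq _ _) (eq _ _))) <|
      .and (.and (ball (Fin.last n).castSucc (eq _ _)) (mem _ _)) <|
      .and (ball (Fin.last (n + 1)) (.or (eq _ _) (eq _ _))) <| .and (mem _ _) (mem _ _)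
  refine h.congr fun C _ v _ => ⟨?_, fun h => ?_⟩
  · rintro ⟨s, hs, t, ht, hst, ⟨h₁, h₂⟩, h₃, h₄, h₅⟩
    have es : s = {v a} := by ext z; simp only [ZFSet.mem_singleton]; grind
    have et : t = {v a, v b} := by ext z; simp only [ZFSet.mem_pair]; grind
    rw [ZFSet.pair, ← es, ← et]
    ext z; simp only [ZFSet.mem_pair]; grind
  · refine ⟨{v a}, by simp [h, ZFSet.pair], {v a, v b}, by simp [h, ZFSet.pair], ?_⟩
    simp [h, ZFSet.pair]

theorem pair_mem (a b c : Fin n) : Dfn.{u} fun _ v => (v a).pair (v b) ∈ v c :=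
  (bex c (Q := fun _ v x => x = (v a).pair (v b))
    (eq_pair (Fin.last n) a.castSucc b.castSucc)).congr fun _ _ _ _ => by simp

end Dfn

theorem TransClass.of_pair_mem {C : Set ZFSet.{u}} (hC : TransClass C) {a b f : ZFSet.{u}}
    (hf : f ∈ C) (h : a.pair b ∈ f) : a ∈ C ∧ b ∈ C := by
  have h₁ : ({a, b} : ZFSet.{u}) ∈ C := hC _ (hC _ hf _ h) _ (by simp [ZFSet.pair])
  exact ⟨hC _ h₁ _ (by simp), hC _ h₁ _ (by simp)⟩

theorem Dfn.cardLtIn {n : ℕ} (s t : Fin n) : Dfn.{u} fun C v => CardLtIn C (v s) (v t) := by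
  have h : Dfn.{u} fun C (v : Fin n → ZFSet.{u}) => ∃ β ∈ v t, ∃ f ∈ C,
      ((∀ p ∈ f, ∃ a ∈ v s, ∃ b ∈ C, p = a.pair b) ∧
        ∀ a ∈ v s, ∃ b ∈ C, a.pair b ∈ f ∧ ∀ b' ∈ C, a.pair b' ∈ f → b' = b) ∧
      (∀ x ∈ C, ∀ y ∈ C, x.pair y ∈ f → y ∈ β) ∧
      ∀ x ∈ C, ∀ x' ∈ C, ∀ y ∈ C, x.pair y ∈ f → x'.pair y ∈ f → x = x' :=
    bex _ <| ex <| .and (.and (ball (Fin.last (n + 1)) (bex s.castSucc.castSucc.castSucc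
      (ex (eq_pair _ _ _)))) (ball s.castSucc.castSucc (ex (.and (pair_mem _ _ _)
        (all (.imp (pair_mem _ _ _) (eq _ _))))))) <|
      .and (all (all (.imp (pair_mem _ _ _) (mem _ _)))) <|
      all (all (all (.imp (pair_mem _ _ _) (.imp (pair_mem _ _ _) (eq _ _)))))
  refine h.congr fun C hC v hv => ⟨?_, ?_⟩
  · rintro ⟨β, hβ, f, hf, ⟨h₁, h₂⟩, h₃, h₄⟩
    have H := fun {a b : ZFSet.{u}} (h : a.pair b ∈ f) => hC.of_pair_mem hf h
    refine ⟨β, f, hβ, hf, ⟨fun p hp => ?_, fun a ha => ?_⟩, fun x y h => ?_, fun x x' y h h' => ?_⟩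
    · obtain ⟨a, ha, b, _, e⟩ := h₁ p hp
      exact ⟨a, b, ha, e⟩
    · obtain ⟨b, _, hb, hb'⟩ := h₂ a ha
      exact ⟨b, hb, fun b' h' => hb' b' (H h').2 h'⟩
    · exact h₃ x (H h).1 y (H h).2 h
    · exact h₄ x (H h).1 x' (H h').1 y (H h).2 h h'
  · rintro ⟨β, f, hβ, hf, ⟨h₁, h₂⟩, h₃, h₄⟩
    have H := fun {a b : ZFSet.{u}} (h : a.pair b ∈ f) => hC.of_pair_mem hf h
    refine ⟨β, hβ, f, hf, ⟨fun p hp => ?_, fun a ha => ?_⟩, fun x _ y _ h => h₃ x y h,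
      fun x _ x' _ y _ h h' => h₄ x x' y h h'⟩
    · obtain ⟨a, b, ha, rfl⟩ := h₁ p hp
      exact ⟨a, ha, b, (H hp).2, rfl⟩
    · obtain ⟨b, hb, hb'⟩ := h₂ a ha
      exact ⟨b, (H hb).2, hb, fun b' _ h' => hb' b' h'⟩

/-- Elementary embeddings between transitive classes preserve definable relations. -/
theorem ElemEmb.transfer {W M : Set ZFSet.{u}} (j : ElemEmb W M) (hW : TransClass W)
    (hM : TransClass M) {n : ℕ} {R : Set ZFSet.{u} → (Fin n → ZFSet.{u}) → Prop} (hR : Dfn R)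
    (v : Fin n → ZFSet.{u}) (hv : ∀ i, v i ∈ W) : R W v ↔ R M fun i => j.toFun (v i) := by
  obtain ⟨φ, hφ⟩ := hR
  rw [← hφ W hW v hv, j.elem φ v hv, hφ M hM _ fun i => j.maps _ (hv i)]

/-! ### Elementary subclasses -/

/-- `H` is an elementary subclass of `N`. -/
def IsElemSub (H N : Set ZFSet.{u}) : Prop :=
  H ⊆ N ∧ ∀ {n : ℕ} (φ : Fml n) (v : Fin n → ZFSet.{u}), (∀ i, v i ∈ H) →
    (φ.Realize H v ↔ φ.Realize N v)

theorem forall_snoc_mem {H : Set ZFSet.{u}} {n : ℕ} {v : Fin n → ZFSet.{u}} {x : ZFSet.{u}}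
    (hv : ∀ i, v i ∈ H) (hx : x ∈ H) (i : Fin (n + 1)) :
    (Fin.snoc v x : Fin (n + 1) → ZFSet.{u}) i ∈ H := by
  refine Fin.lastCases ?_ (fun i => ?_) i
  · simpa using hx
  · simpa using hv i

/-- The Tarski–Vaught test. -/
theorem isElemSub_of_witnesses {H N : Set ZFSet.{u}} (hHN : H ⊆ N)
    (h : ∀ {n : ℕ} (φ : Fml (n + 1)) (v : Fin n → ZFSet.{u}), (∀ i, v i ∈ H) →
      (∃ x ∈ N, φ.Realize N (Fin.snoc v x)) → ∃ x ∈ H, φ.Realize N (Fin.snoc v x)) :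
    IsElemSub H N := by
  refine ⟨hHN, fun {n} φ v hv => ?_⟩
  induction φ with
  | mem i j => rfl
  | eq i j => rfl
  | not φ ih => exact not_congr (ih v hv)
  | and φ ψ ih₁ ih₂ => exact and_congr (ih₁ v hv) (ih₂ v hv)
  | ex φ ih =>
    constructor
    · rintro ⟨x, hx, hφ⟩
      exact ⟨x, hHN hx, (ih _ (forall_snoc_mem hv hx)).1 hφ⟩
    · intro hφ
      obtain ⟨x, hx, hφ⟩ := h φ v hv hφ
      exact ⟨x, hx, (ih _ (forall_snoc_mem hv hx)).2 hφ⟩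

/-- Downward Löwenheim–Skolem for classes. -/
theorem exists_isElemSub {N : Set ZFSet.{u}} {Y₀ : ZFSet.{u}} (hY₀ : ∀ x ∈ Y₀, x ∈ N) :
    ∃ Y : ZFSet.{u}, Y₀ ⊆ Y ∧ IsElemSub {x | x ∈ Y} N := by
  classical
  have hwit : ∀ (n : ℕ) (φ : Fml (n + 1)) (v : Fin n → ZFSet.{u}), ∃ x : ZFSet.{u},
      (∃ x ∈ N, φ.Realize N (Fin.snoc v x)) → x ∈ N ∧ φ.Realize N (Fin.snoc v x) := by
    intro n φ v
    by_cases h : ∃ x ∈ N, φ.Realize N (Fin.snoc v x)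
    · exact ⟨h.choose, fun _ => h.choose_spec⟩
    · exact ⟨∅, fun h' => (h h').elim⟩
  choose wit hwit using hwit
  let step : ZFSet.{u} → ZFSet.{u} := fun Y =>
    ZFSet.sep (· ∈ N) (Y ∪ ZFSet.range fun q : Σ n : ℕ, Fml (n + 1) × (Fin n → Y) =>
      wit q.1 q.2.1 fun i => q.2.2 i)
  let Z : ℕ → ZFSet.{u} := fun k => step^[k] Y₀
  have hZN : ∀ k, ∀ x ∈ Z k, x ∈ N := by
    intro k
    cases k with
    | zero => exact hY₀
    | succ k =>
      intro x hx
      simp only [Z, Function.iterate_succ_apply'] at hx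
      exact (ZFSet.mem_sep.1 hx).2
  have hmono : Monotone fun k => {x | x ∈ Z k} := by
    refine monotone_nat_of_le_succ fun k x hx => ?_
    simp only [Z, Function.iterate_succ_apply', Set.mem_ofPred_eq]
    exact ZFSet.mem_sep.2 ⟨ZFSet.mem_union.2 (.inl hx), hZN k x hx⟩
  refine ⟨ZFSet.iUnion Z, ZFSet.subset_iUnion Z 0, isElemSub_of_witnesses ?_ ?_⟩
  · intro x hx
    obtain ⟨k, hk⟩ := ZFSet.mem_iUnion.1 hx
    exact hZN k x hk
  · intro n φ v hv hφ
    choose k hk using fun i => ZFSet.mem_iUnion.1 (hv i)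
    let K := Finset.univ.sup k
    have hK : ∀ i, v i ∈ Z K := fun i => hmono (Finset.le_sup (Finset.mem_univ i)) (hk i)
    obtain ⟨h₁, h₂⟩ := hwit n φ v hφ
    refine ⟨wit n φ v, ZFSet.mem_iUnion.2 ⟨K + 1, ?_⟩, h₂⟩
    simp only [Function.iterate_succ_apply']
    exact ZFSet.mem_sep.2 ⟨ZFSet.mem_union.2 (.inr (ZFSet.mem_range.2
      ⟨⟨n, φ, fun i => ⟨v i, hK i⟩⟩, rfl⟩)), h₁⟩

theorem exists_isElemSub_union {N : Set ZFSet.{u}} {Y Z : ZFSet.{u}} (hY : IsElemSub {y | y ∈ Y} N)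
    (hZ : IsElemSub {y | y ∈ Z} N) :
    ∃ T : ZFSet.{u}, Y ⊆ T ∧ Z ⊆ T ∧ IsElemSub {y | y ∈ T} N := by
  obtain ⟨T, hT, h⟩ := exists_isElemSub (N := N) (Y₀ := Y ∪ Z) fun x hx =>
    (ZFSet.mem_union.1 hx).elim (fun h => hY.1 h) fun h => hZ.1 h
  exact ⟨T, fun x hx => hT (ZFSet.mem_union.2 (.inl hx)),
    fun x hx => hT (ZFSet.mem_union.2 (.inr hx)), h⟩

theorem transClass_univ : TransClass (Set.univ : Set ZFSet.{u}) := fun _ _ _ _ => trivial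

/-! ### The image of a transitive class under an elementary embedding -/

/-- The union of the `j Y`, where `Y` ranges over the sets that are elementary in `N`. -/
def imageClass (j : ZFSet.{u} → ZFSet.{u}) (N : Set ZFSet.{u}) : Set ZFSet.{u} :=
  {x | ∃ Y : ZFSet.{u}, IsElemSub {y | y ∈ Y} N ∧ x ∈ j Y}

section ImageClass

variable {M N : Set ZFSet.{u}} (j : ElemEmb Set.univ M)

theorem ElemEmb.subset_iff (hM : TransClass M) (Y Z : ZFSet.{u}) :
    (∀ x ∈ Y, x ∈ Z) ↔ ∀ x ∈ j.toFun Y, x ∈ j.toFun Z :=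
  j.transfer transClass_univ hM (R := fun _ (v : Fin 2 → ZFSet.{u}) => ∀ x ∈ v 0, x ∈ v 1)
    (.ball 0 (.mem _ _)) ![Y, Z] fun _ => trivial

theorem ElemEmb.mem_iff (hM : TransClass M) (Y Z : ZFSet.{u}) : Y ∈ Z ↔ j.toFun Y ∈ j.toFun Z :=
  j.transfer transClass_univ hM (R := fun _ (v : Fin 2 → ZFSet.{u}) => v 0 ∈ v 1) (.mem 0 1)
    ![Y, Z] fun _ => trivial

theorem realize_image_iff (hM : TransClass M) {Y Z : ZFSet.{u}} (hY : IsElemSub {y | y ∈ Y} N)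
    (hZ : IsElemSub {y | y ∈ Z} N) (hYZ : Y ⊆ Z) {n : ℕ} (φ : Fml n) (v : Fin n → ZFSet.{u})
    (hv : ∀ i, v i ∈ j.toFun Y) :
    φ.Realize {y | y ∈ j.toFun Y} v ↔ φ.Realize {y | y ∈ j.toFun Z} v := by
  have hD : Dfn.{u} fun C (w : Fin 2 → ZFSet.{u}) => ∀ v : Fin n → ZFSet.{u}, (∀ i, v i ∈ C) →
      (∀ i, v i ∈ w 0) → (φ.Realize {y | y ∈ w 0} v ↔ φ.Realize {y | y ∈ w 1} v) :=
    .forall_tuple (.imp (.forall_fin fun _ => .mem _ _)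
      (.iff (.realize_of_mem φ _ _) (.realize_of_mem φ _ _)))
  refine (j.transfer transClass_univ hM hD ![Y, Z] fun _ => trivial).1 ?_ v
    (fun i => hM _ (j.maps Y trivial) _ (hv i)) hv
  intro v _ hv
  exact (hY.2 φ v hv).trans (hZ.2 φ v fun i => hYZ (hv i)).symm

theorem realize_imageClass_iff (hM : TransClass M) {Y : ZFSet.{u}}
    (hY : IsElemSub {y | y ∈ Y} N) {n : ℕ} (φ : Fml n) (v : Fin n → ZFSet.{u})
    (hv : ∀ i, v i ∈ j.toFun Y) :
    φ.Realize (imageClass j.toFun N) v ↔ φ.Realize {y | y ∈ j.toFun Y} v := by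
  induction φ generalizing Y with
  | mem i j => rfl
  | eq i j => rfl
  | not φ ih => exact not_congr (ih hY v hv)
  | and φ ψ ih₁ ih₂ => exact and_congr (ih₁ hY v hv) (ih₂ hY v hv)
  | ex φ ih =>
    constructor
    · rintro ⟨x, ⟨Z, hZ, hx⟩, hφ⟩
      obtain ⟨T, hYT, hZT, hT⟩ := exists_isElemSub_union hY hZ
      have hvT : ∀ i, v i ∈ j.toFun T := fun i => (j.subset_iff hM Y T).1 hYT _ (hv i)
      have hxT : x ∈ j.toFun T := (j.subset_iff hM Z T).1 hZT _ hx
      exact (realize_image_iff j hM hY hT hYT φ.ex v hv).2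
        ⟨x, hxT, (ih hT _ (forall_snoc_mem (H := {y | y ∈ j.toFun T}) hvT hxT)).1 hφ⟩
    · rintro ⟨x, hx, hφ⟩
      exact ⟨x, ⟨Y, hY, hx⟩, (ih hY _ (forall_snoc_mem (H := {y | y ∈ j.toFun Y}) hv hx)).2 hφ⟩

theorem transClass_imageClass (hM : TransClass M) (hN : TransClass N) :
    TransClass (imageClass j.toFun N) := by
  rintro x ⟨Y, hY, hx⟩ y hy
  obtain ⟨T, hT, h⟩ := exists_isElemSub (N := N) (Y₀ := ZFSet.sUnion Y) fun z hz => by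
    obtain ⟨w, hw, hzw⟩ := ZFSet.mem_sUnion.1 hz
    exact hN _ (hY.1 hw) _ hzw
  refine ⟨T, h, (j.transfer transClass_univ hM
    (R := fun _ (v : Fin 2 → ZFSet.{u}) => ∀ x ∈ v 0, ∀ y ∈ x, y ∈ v 1)
    (.ball 0 (.ball (Fin.last 2) (.mem _ _))) ![Y, T] fun _ => trivial).1 ?_ x hx y hy⟩
  exact fun x hx y hy => hT (ZFSet.mem_sUnion.2 ⟨x, hx, hy⟩)

/-- The restriction of `j` to `N`, as an elementary embedding into the image class. -/
def ElemEmb.restrict (hM : TransClass M) (N : Set ZFSet.{u}) :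
    ElemEmb N (imageClass j.toFun N) where
  toFun := j.toFun
  maps x hx := by
    obtain ⟨T, hT, h⟩ := exists_isElemSub (N := N) (Y₀ := {x}) (by simpa using hx)
    exact ⟨T, h, (j.mem_iff hM x T).1 (hT (by simp))⟩
  elem {n} φ v hv := by
    obtain ⟨T, hT, h⟩ := exists_isElemSub (N := N) (Y₀ := ZFSet.range v) (by simpa using hv)
    have hvT : ∀ i, v i ∈ T := fun i => hT (by simp)
    rw [realize_imageClass_iff j hM h φ _ fun i => (j.mem_iff hM _ T).1 (hvT i),
      ← h.2 φ v hvT]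
    have hD : Dfn.{u} fun _ (w : Fin (n + 1) → ZFSet.{u}) =>
        φ.Realize {y | y ∈ w (Fin.last n)} fun i => w i.castSucc := .realize_of_mem φ _ _
    simpa using j.transfer transClass_univ hM hD (Fin.snoc v T) fun _ => trivial

end ImageClass

/-- Composition of elementary embeddings. -/
def ElemEmb.comp {W M N : Set ZFSet.{u}} (j : ElemEmb M N) (i : ElemEmb W M) : ElemEmb W N where
  toFun x := j.toFun (i.toFun x)
  maps x hx := j.maps _ (i.maps x hx)
  elem φ v hv := (i.elem φ v hv).trans (j.elem φ _ fun k => i.maps _ (hv k))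

/-! ### The transitive collapse -/

/-- The transitive collapse of the class `H`. -/
noncomputable def collapse (H : Set ZFSet.{u}) (x : ZFSet.{u}) : ZFSet.{u} :=
  ZFSet.range fun y : {y : x // (y : ZFSet.{u}) ∈ H} => collapse H y
termination_by x
decreasing_by exact y.1.2

theorem mem_collapse {H : Set ZFSet.{u}} {x z : ZFSet.{u}} :
    z ∈ collapse H x ↔ ∃ y ∈ x, y ∈ H ∧ collapse H y = z := by
  rw [collapse, ZFSet.mem_range]
  constructor
  · rintro ⟨y, rfl⟩
    exact ⟨y, y.1.2, y.2, rfl⟩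
  · rintro ⟨y, hy, hH, rfl⟩
    exact ⟨⟨⟨y, hy⟩, hH⟩, rfl⟩

theorem collapse_eq_self {H : Set ZFSet.{u}} {T : ZFSet.{u}} (hT : T.IsTransitive)
    (hH : ∀ x ∈ T, x ∈ H) {x : ZFSet.{u}} (hx : x ∈ T) : collapse H x = x := by
  induction x using ZFSet.inductionOn with
  | h x ih =>
    ext z
    rw [mem_collapse]
    constructor
    · rintro ⟨y, hy, -, rfl⟩
      rwa [ih y hy (hT.mem_trans hy hx)]
    · exact fun hz => ⟨z, hz, hH z (hT.mem_trans hz hx), ih z hz (hT.mem_trans hz hx)⟩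

theorem transClass_collapse (H : Set ZFSet.{u}) : TransClass (collapse H '' H) := by
  rintro _ ⟨x, -, rfl⟩ y hy
  obtain ⟨z, -, hz, rfl⟩ := mem_collapse.1 hy
  exact ⟨z, hz, rfl⟩

section Collapse

variable {H N : Set ZFSet.{u}}

theorem IsElemSub.subset_of_forall (hN : TransClass N) (hH : IsElemSub H N)
    {x y : ZFSet.{u}} (hx : x ∈ H) (hy : y ∈ H)
    (h : ∀ z ∈ H, z ∈ x → z ∈ y) : x ⊆ y := by
  intro z hz
  by_contra hzy
  obtain ⟨w, hw, h₁, h₂⟩ := (hH.2 (.ex (.and (.mem 2 0) (.not (.mem 2 1)))) ![x, y] (by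
    intro i
    fin_cases i
    exacts [hx, hy])).2 ⟨z, hN _ (hH.1 hx) _ hz, hz, hzy⟩
  exact h₂ (h w hw h₁)

theorem collapse_injOn (hN : TransClass N) (hH : IsElemSub H N) :
    Set.InjOn (collapse H) H := by
  intro x
  induction x using ZFSet.inductionOn with
  | h x ih =>
    intro hx y hy hxy
    refine le_antisymm (hH.subset_of_forall hN hx hy fun z hz hzx => ?_)
      (hH.subset_of_forall hN hy hx fun z hz hzy => ?_)
    · obtain ⟨w, hw, hwH, e⟩ := mem_collapse.1 (hxy ▸ mem_collapse.2 ⟨z, hzx, hz, rfl⟩)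
      rwa [ih z hzx hz hwH e.symm]
    · obtain ⟨w, hw, hwH, e⟩ := mem_collapse.1 (hxy ▸ mem_collapse.2 ⟨z, hzy, hz, rfl⟩)
      rwa [← ih w hw hwH hz e]

theorem collapse_mem_iff (hN : TransClass N) (hH : IsElemSub H N)
    {x y : ZFSet.{u}} (hx : x ∈ H) :
    collapse H x ∈ collapse H y ↔ x ∈ y := by
  rw [mem_collapse]
  constructor
  · rintro ⟨z, hz, hzH, e⟩
    rwa [← collapse_injOn hN hH hzH hx e]
  · exact fun h => ⟨x, h, hx, rfl⟩

theorem realize_collapse_iff (hN : TransClass N) (hH : IsElemSub H N)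
    {n : ℕ} (φ : Fml n) (v : Fin n → ZFSet.{u}) (hv : ∀ i, v i ∈ H) :
    φ.Realize (collapse H '' H) (fun i => collapse H (v i)) ↔ φ.Realize N v := by
  rw [← hH.2 φ v hv]
  induction φ with
  | mem i j => exact collapse_mem_iff hN hH (hv i)
  | eq i j => exact (collapse_injOn hN hH).eq_iff (hv i) (hv j)
  | not φ ih => exact not_congr (ih v hv)
  | and φ ψ ih₁ ih₂ => exact and_congr (ih₁ v hv) (ih₂ v hv)
  | @ex n φ ih =>
    have key : ∀ x, (Fin.snoc (fun i => collapse H (v i)) (collapse H x) : Fin (n + 1) → ZFSet) =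
        fun i => collapse H ((Fin.snoc v x : Fin (n + 1) → ZFSet) i) := by
      intro x
      funext i
      refine Fin.lastCases ?_ (fun i => ?_) i <;> simp
    constructor
    · rintro ⟨_, ⟨x, hx, rfl⟩, hφ⟩
      rw [key] at hφ
      exact ⟨x, hx, (ih _ (forall_snoc_mem hv hx)).1 hφ⟩
    · rintro ⟨x, hx, hφ⟩
      refine ⟨_, ⟨x, hx, rfl⟩, ?_⟩
      rw [key]
      exact (ih _ (forall_snoc_mem hv hx)).2 hφ

/-- The composition of an elementary embedding into `N`, with values in `H`, and the
transitive collapse of `H`. -/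
noncomputable def ElemEmb.collapseComp (hN : TransClass N) (hH : IsElemSub H N)
    {W : Set ZFSet.{u}} (k : ElemEmb W N)
    (hk : ∀ x ∈ W, k.toFun x ∈ H) : ElemEmb W (collapse H '' H) where
  toFun x := collapse H (k.toFun x)
  maps x hx := ⟨_, hk x hx, rfl⟩
  elem φ v hv := (k.elem φ v hv).trans
    (realize_collapse_iff hN hH φ _ fun i => hk _ (hv i)).symm

end Collapse

/-! ### Cardinalities of sets -/

open Cardinal

theorem card_le_iff_exists_injOn {a b : ZFSet.{u}} :
    a.card ≤ b.card ↔ ∃ g : ZFSet.{u} → ZFSet.{u}, (∀ x ∈ a, g x ∈ b) ∧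
      ∀ x ∈ a, ∀ y ∈ a, g x = g y → x = y := by
  classical
  rw [← lift_le.{u + 1}, ← ZFSet.cardinalMk_coe_sort, ← ZFSet.cardinalMk_coe_sort]
  constructor
  · rintro ⟨e⟩
    refine ⟨fun x => if h : x ∈ a then e ⟨x, h⟩ else ∅, fun x hx => ?_, fun x hx y hy h => ?_⟩
    · simp only [hx, dite_true]
      exact (e ⟨x, hx⟩).2
    · simp only [hx, hy, dite_true] at h
      simpa using e.injective (Subtype.ext h)
  · rintro ⟨g, hg, hinj⟩
    exact ⟨⟨fun x => ⟨g x, hg x x.2⟩, fun x y h =>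
      Subtype.ext (hinj x x.2 y y.2 (congrArg Subtype.val h))⟩⟩

theorem exists_injection_iff {a b : ZFSet.{u}} :
    (∃ f : ZFSet.{u}, IsFuncOn a f ∧ MapsInto f b ∧ InjFun f) ↔
      ∃ g : ZFSet.{u} → ZFSet.{u}, (∀ x ∈ a, g x ∈ b) ∧
        ∀ x ∈ a, ∀ y ∈ a, g x = g y → x = y := by
  constructor
  · rintro ⟨f, ⟨-, hf⟩, hb, hinj⟩
    have : ∀ x, ∃ y, x ∈ a → x.pair y ∈ f := fun x => by
      by_cases hx : x ∈ a
      · obtain ⟨y, hy, -⟩ := hf x hx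
        exact ⟨y, fun _ => hy⟩
      · exact ⟨∅, fun h => absurd h hx⟩
    choose g hg using this
    exact ⟨g, fun x hx => hb _ _ (hg x hx), fun x hx y hy h =>
      hinj _ _ _ (hg x hx) (h ▸ hg y hy)⟩
  · rintro ⟨g, hb, hinj⟩
    have hmem : ∀ x y, x.pair y ∈ (ZFSet.range fun x : a => (x : ZFSet.{u}).pair (g x)) ↔
        x ∈ a ∧ y = g x := by
      intro x y
      rw [ZFSet.mem_range]
      constructor
      · rintro ⟨z, hz⟩
        obtain ⟨rfl, rfl⟩ := ZFSet.pair_injective hz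
        exact ⟨z.2, rfl⟩
      · rintro ⟨hx, rfl⟩
        exact ⟨⟨x, hx⟩, rfl⟩
    refine ⟨ZFSet.range fun x : a => (x : ZFSet.{u}).pair (g x), ⟨fun p hp => ?_, fun x hx => ?_⟩,
      fun x y h => ?_, fun x x' y h h' => ?_⟩
    · obtain ⟨x, rfl⟩ := ZFSet.mem_range.1 hp
      exact ⟨x, g x, x.2, rfl⟩
    · exact ⟨g x, (hmem _ _).2 ⟨hx, rfl⟩, fun y hy => ((hmem _ _).1 hy).2⟩
    · obtain ⟨hx, rfl⟩ := (hmem _ _).1 h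
      exact hb x hx
    · obtain ⟨hx, rfl⟩ := (hmem _ _).1 h
      obtain ⟨hx', e⟩ := (hmem _ _).1 h'
      exact hinj x hx x' hx' e

theorem cardLtIn_univ_iff {s t : ZFSet.{u}} :
    CardLtIn Set.univ s t ↔ ∃ β ∈ t, s.card ≤ β.card := by
  simp only [card_le_iff_exists_injOn, ← exists_injection_iff, CardLtIn, Set.mem_univ, true_and,
    exists_and_left]

theorem card_range_le {α : Type (u + 1)} [Small.{u} α] (f : α → ZFSet.{u}) :
    lift.{u + 1} (ZFSet.range f).card ≤ #α :=
  ZFSet.lift_card_range_le.trans (lift_id'.{u, u + 1} #α).le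

theorem card_iUnion_le {α : Type u} (f : α → ZFSet.{u}) {c : Cardinal.{u}} (hc : ℵ₀ ≤ c)
    (hα : #α ≤ c) (hf : ∀ i, (f i).card ≤ c) : (ZFSet.iUnion f).card ≤ c := by
  have h := ZFSet.lift_card_iUnion_le_sum_card (f := f)
  rw [lift_id'] at h
  calc _ ≤ _ := h
    _ ≤ sum fun _ : α => c := sum_le_sum _ _ hf
    _ = #α * c := by simp
    _ ≤ c * c := by gcongr
    _ = c := mul_eq_self hc

/-! ### Families of sets coded by sets -/

/-- The set of pairs coding the family `G` restricted to `D`. -/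
noncomputable def famGraph (D : ZFSet.{u}) (G : ZFSet.{u} → ZFSet.{u}) : ZFSet.{u} :=
  ZFSet.range fun q : (Σ p : D, G p) => (q.1 : ZFSet.{u}).pair q.2

theorem pair_mem_famGraph {D p x : ZFSet.{u}} {G : ZFSet.{u} → ZFSet.{u}} :
    p.pair x ∈ famGraph D G ↔ p ∈ D ∧ x ∈ G p := by
  rw [famGraph, ZFSet.mem_range]
  constructor
  · rintro ⟨⟨⟨p', hp⟩, ⟨x', hx⟩⟩, h⟩
    obtain ⟨rfl, rfl⟩ := ZFSet.pair_injective h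
    exact ⟨hp, hx⟩
  · rintro ⟨hp, hx⟩
    exact ⟨⟨⟨p, hp⟩, ⟨x, hx⟩⟩, rfl⟩

/-- The hull of `t` under the values at `t` of the families `G` in the domain of `k` such that
`G p` has at most as many elements as `p`. -/
def hull {N : Set ZFSet.{u}} (k : ElemEmb Set.univ N) (D t : ZFSet.{u}) : Set ZFSet.{u} :=
  {x | ∃ G : ZFSet.{u} → ZFSet.{u}, (∀ p ∈ D, (G p).card ≤ p.card) ∧
    t.pair x ∈ k.toFun (famGraph D G)}

section Hull

variable {N : Set ZFSet.{u}} {k : ElemEmb Set.univ N} {D t : ZFSet.{u}}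

theorem hull_subset (hN : TransClass N) : hull k D t ⊆ N := fun _ ⟨_, _, hx⟩ =>
  (hN.of_pair_mem (k.maps _ trivial) hx).2

theorem exists_common_family (hN : TransClass N) (hD : ∀ p ∈ D, ℵ₀ ≤ p.card) {n : ℕ}
    (v : Fin n → ZFSet.{u}) (hv : ∀ i, v i ∈ hull k D t) :
    ∃ G : ZFSet.{u} → ZFSet.{u}, (∀ p ∈ D, (G p).card ≤ p.card) ∧
      ∀ i, t.pair (v i) ∈ k.toFun (famGraph D G) := by
  choose G hG hv using hv
  refine ⟨fun p => ZFSet.iUnion fun i : ULift.{u} (Fin n) => G i.down p, fun p hp =>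
    card_iUnion_le _ (hD p hp) ?_ fun i => hG _ p hp, fun i => ?_⟩
  · simpa using (natCast_lt_aleph0 (n := n)).le.trans (hD p hp)
  · refine (k.subset_iff hN _ _).1 (fun q hq => ?_) _ (hv i)
    obtain ⟨a, rfl⟩ := ZFSet.mem_range.1 hq
    exact pair_mem_famGraph.2 ⟨a.1.2, ZFSet.mem_iUnion.2 ⟨⟨i⟩, a.2.2⟩⟩

theorem mem_hull_of_mem (hN : TransClass N) (ht : t ∈ k.toFun D) {x : ZFSet.{u}} (hx : x ∈ t) :
    x ∈ hull k D t := by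
  refine ⟨id, fun p _ => le_rfl, ?_⟩
  have h : Dfn.{u} fun _ (v : Fin 2 → ZFSet.{u}) => ∀ p ∈ v 0, ∀ x ∈ p, p.pair x ∈ v 1 :=
    .ball _ <| .ball (Fin.last 2) <| .pair_mem _ _ _
  exact (k.transfer transClass_univ hN h ![D, famGraph D id] fun _ => trivial).1
    (fun p hp x hx => pair_mem_famGraph.2 ⟨hp, hx⟩) t ht x hx

theorem apply_mem_hull (hN : TransClass N) (ht : t ∈ k.toFun D)
    (hD : ∀ p ∈ D, ℵ₀ ≤ p.card) (y : ZFSet.{u}) : k.toFun y ∈ hull k D t := by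
  refine ⟨fun _ => {y}, fun p hp => ?_, ?_⟩
  · rw [ZFSet.card_singleton]
    exact one_le_aleph0.trans (hD p hp)
  have h : Dfn.{u} fun _ (v : Fin 3 → ZFSet.{u}) => ∀ p ∈ v 0, p.pair (v 2) ∈ v 1 :=
    .ball _ <| .pair_mem (Fin.last 3) (Fin.castSucc 2) (Fin.castSucc 1)
  exact (k.transfer transClass_univ hN h ![D, famGraph D fun _ => {y}, y] fun _ => trivial).1
    (fun p hp => (pair_mem_famGraph (G := fun _ => {y})).2 ⟨hp, ZFSet.mem_singleton.2 rfl⟩) t ht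

theorem isElemSub_hull (hN : TransClass N) (ht : t ∈ k.toFun D)
    (hD : ∀ p ∈ D, ℵ₀ ≤ p.card) : IsElemSub (hull k D t) N := by
  refine isElemSub_of_witnesses (hull_subset hN) fun {n} φ v hv hφ => ?_
  obtain ⟨G, hG, hv'⟩ := exists_common_family hN hD v hv
  have hwit : ∀ w : Fin n → ZFSet.{u}, ∃ x : ZFSet.{u},
      (∃ x, φ.Realize Set.univ (Fin.snoc w x)) → φ.Realize Set.univ (Fin.snoc w x) := by
    intro w
    by_cases h : ∃ x, φ.Realize Set.univ (Fin.snoc w x)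
    · exact ⟨h.choose, fun _ => h.choose_spec⟩
    · exact ⟨∅, fun h' => absurd h' h⟩
  choose wit hwit using hwit
  let G' : ZFSet.{u} → ZFSet.{u} := fun p => ZFSet.range fun w : Fin n → G p =>
    wit fun i => (w i : ZFSet.{u})
  have hG' : ∀ p ∈ D, (G' p).card ≤ p.card := fun p hp => by
    rw [← lift_le.{u + 1}]
    refine (card_range_le _).trans ?_
    have h₁ : #(G p) ≤ lift.{u + 1} p.card := by
      rw [ZFSet.cardinalMk_coe_sort]
      exact lift_le.2 (hG p hp)
    have h₂ : ℵ₀ ≤ lift.{u + 1} p.card := aleph0_le_lift.2 (hD p hp)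
    calc #(Fin n → G p) = #(G p) ^ n := by simp
      _ ≤ lift.{u + 1} p.card ^ n := by gcongr
      _ ≤ lift.{u + 1} p.card := power_nat_le h₂
  have h : Dfn.{u} fun C (u : Fin 3 → ZFSet.{u}) => ∀ p ∈ u 0, ∀ w : Fin n → ZFSet.{u},
      (∀ i, w i ∈ C) → (∀ i, p.pair (w i) ∈ u 1) → (∃ x ∈ C, φ.Realize C (Fin.snoc w x)) →
        ∃ x ∈ C, p.pair x ∈ u 2 ∧ φ.Realize C (Fin.snoc w x) := by
    refine .ball _ <| .forall_tuple <| .imp (.forall_fin fun i => ?_) <| .imp ?_ ?_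
    · exact .pair_mem (Fin.castAdd n (Fin.last 3)) (Fin.natAdd 4 i) (Fin.castAdd n 1)
    · exact .realize φ.ex (Fin.natAdd 4)
    · refine .ex <| .and (.pair_mem (Fin.castAdd n (Fin.last 3)).castSucc (Fin.last _)
        (Fin.castAdd n 2).castSucc) ?_
      refine (Dfn.realize φ (Fin.snoc (fun i => (Fin.natAdd 4 i).castSucc) (Fin.last _))).congr
        fun C _ w _ => ?_
      refine iff_of_eq (congrArg _ (funext fun i => ?_))
      refine Fin.lastCases ?_ (fun i => ?_) i <;> simp [Fin.init]
  obtain ⟨x, hxN, hx, hφx⟩ := (k.transfer transClass_univ hN h ![D, famGraph D G, famGraph D G']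
    fun _ => trivial).1 (by
      rintro p hp w - hw ⟨x, -, hx⟩
      refine ⟨wit w, trivial, pair_mem_famGraph.2 ⟨hp, ?_⟩, hwit w ⟨x, hx⟩⟩
      exact ZFSet.mem_range.2 ⟨fun i => ⟨w i, (pair_mem_famGraph.1 (hw i)).2⟩, rfl⟩)
    t ht v (fun i => hull_subset hN (hv i)) hv' hφ
  exact ⟨x, ⟨G', hG', hx⟩, hφx⟩

theorem exists_cover_mem_hull (hN : TransClass N) (ht : t ∈ k.toFun D)
    (hD : ∀ p ∈ D, ℵ₀ ≤ p.card) {κ lam : ZFSet.{u}} (hDlam : ∀ p ∈ D, p ⊆ lam)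
    (hDκ : ∀ p ∈ D, ∃ β ∈ κ, p.card ≤ β.card) (hlam : ∀ α ∈ lam, k.toFun α ∈ t)
    (x : lam → ZFSet.{u}) (hx : ∀ α, x α ∈ hull k D t) :
    ∃ Z ∈ hull k D t, (∀ α, x α ∈ Z) ∧ CardLtIn N Z (k.toFun κ) := by
  classical
  choose G hG hx using hx
  let U : ZFSet.{u} → ZFSet.{u} := fun p =>
    ZFSet.iUnion fun β : Shrink.{u} p =>
      if h : ((equivShrink p).symm β : ZFSet.{u}) ∈ lam then G ⟨_, h⟩ p else ∅
  have hU : ∀ p ∈ D, (U p).card ≤ p.card := fun p hp => by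
    refine card_iUnion_le _ (hD p hp) le_rfl fun β => ?_
    rw [dif_pos (hDlam p hp ((equivShrink p).symm β).2)]
    exact hG _ p hp
  have hGU : ∀ (α : lam), ∀ p ∈ D, (α : ZFSet.{u}) ∈ p → G α p ⊆ U p := fun α p hp hα z hz => by
    refine ZFSet.mem_iUnion.2 ⟨equivShrink p ⟨α, hα⟩, ?_⟩
    rw [dif_pos (by simp)]
    simpa using hz
  have h : Dfn.{u} fun C (v : Fin 4 → ZFSet.{u}) => ∀ p ∈ v 0, ∃ z ∈ C, p.pair z ∈ v 1 ∧
      (∀ x ∈ C, p.pair x ∈ v 2 → x ∈ z) ∧ CardLtIn C z (v 3) :=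
    .ball _ <| .ex <| .and (.pair_mem (Fin.last 4).castSucc (Fin.last 5)
      (Fin.castSucc (Fin.castSucc 1))) <|
      .and (.all <| .imp (.pair_mem (Fin.last 4).castSucc.castSucc (Fin.last 6)
        (Fin.castSucc (Fin.castSucc (Fin.castSucc 2)))) (.mem _ _))
        (.cardLtIn (Fin.last 5) (Fin.castSucc (Fin.castSucc 3)))
  obtain ⟨Z, -, hZ, hsub, hcard⟩ := (k.transfer transClass_univ hN h
    ![D, famGraph D fun p => {U p}, famGraph D U, κ] fun _ => trivial).1 (fun p hp =>
      ⟨U p, trivial, (pair_mem_famGraph (G := fun p => {U p})).2 ⟨hp, ZFSet.mem_singleton.2 rfl⟩,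
        fun z _ hz => (pair_mem_famGraph.1 hz).2, cardLtIn_univ_iff.2 <| by
          obtain ⟨β, hβ, hpβ⟩ := hDκ p hp
          exact ⟨β, hβ, (hU p hp).trans hpβ⟩⟩) t ht
  refine ⟨Z, ⟨fun p => {U p}, fun p hp => ?_, hZ⟩, fun α => hsub _ (hull_subset hN
    ⟨G α, hG α, hx α⟩) ?_, hcard⟩
  · rw [ZFSet.card_singleton]
    exact one_le_aleph0.trans (hD p hp)
  have h : Dfn.{u} fun C (v : Fin 4 → ZFSet.{u}) => ∀ p ∈ v 0, v 1 ∈ p →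
      ∀ x ∈ C, p.pair x ∈ v 2 → p.pair x ∈ v 3 :=
    .ball _ <| .imp (.mem (Fin.castSucc 1) (Fin.last 4)) <| .all <|
      .imp (.pair_mem (Fin.last 4).castSucc (Fin.last 5) (Fin.castSucc (Fin.castSucc 2)))
        (.pair_mem (Fin.last 4).castSucc (Fin.last 5) (Fin.castSucc (Fin.castSucc 3)))
  exact (k.transfer transClass_univ hN h ![D, α, famGraph D (G α), famGraph D U]
    fun _ => trivial).1 (fun p hp hα z _ hz => pair_mem_famGraph.2
      ⟨hp, hGU α p hp hα (pair_mem_famGraph.1 hz).2⟩) t ht (hlam α α.2) _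
    (hull_subset hN ⟨G α, hG α, hx α⟩) (hx α)

end Hull

/-! ### Ordinals and critical points -/

theorem isOrd_iff {x : ZFSet.{u}} : IsOrd x ↔ x.IsOrdinal :=
  ZFSet.isOrdinal_iff_forall_mem_isTransitive.symm

theorem isOrdinal_apply {N : Set ZFSet.{u}} (k : ElemEmb Set.univ N) (hN : TransClass N)
    {x : ZFSet.{u}} (hx : x.IsOrdinal) : (k.toFun x).IsOrdinal := by
  have h : Dfn.{u} fun _ (v : Fin 1 → ZFSet.{u}) =>
      (∀ y ∈ v 0, ∀ z ∈ y, z ∈ v 0) ∧ ∀ y ∈ v 0, ∀ z ∈ y, ∀ w ∈ z, w ∈ y :=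
    .and (.ball _ <| .ball (Fin.last 1) <| .mem _ _)
      (.ball _ <| .ball (Fin.last 1) <| .ball (Fin.last 2) <| .mem _ _)
  obtain ⟨h₁, h₂⟩ := (k.transfer transClass_univ hN h ![x] fun _ => trivial).1
    ⟨fun y hy z hz => hx.mem_trans hz hy, fun y hy z hz w hw => (hx.mem hy).mem_trans hw hz⟩
  exact isOrd_iff.1 ⟨fun y hy z hz => h₁ y hy z hz, fun y hy z hz w hw => h₂ y hy z hz w hw⟩

/-- The set of natural numbers as a von Neumann ordinal. -/
noncomputable def omegaSet : ZFSet.{u} := Ordinal.omega0.toZFSet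

theorem eq_empty_or_insert_of_mem_omegaSet {x : ZFSet.{u}} (hx : x ∈ omegaSet) :
    x = ∅ ∨ ∃ m, x = insert m m := by
  obtain ⟨a, ha, rfl⟩ := Ordinal.mem_toZFSet_iff.1 hx
  obtain ⟨n, rfl⟩ := Ordinal.lt_omega0.1 ha
  cases n with
  | zero => simp
  | succ n => exact .inr ⟨_, by rw [Nat.cast_succ, Ordinal.toZFSet_add_one]⟩

theorem insert_mem_omegaSet {x : ZFSet.{u}} (hx : x ∈ omegaSet) : insert x x ∈ omegaSet.{u} := by
  obtain ⟨a, ha, rfl⟩ := Ordinal.mem_toZFSet_iff.1 hx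
  rw [← Ordinal.toZFSet_add_one]
  exact Ordinal.toZFSet_mem_toZFSet_iff.2 (Ordinal.isSuccLimit_omega0.add_one_lt ha)

theorem empty_mem_omegaSet : ∅ ∈ omegaSet.{u} :=
  Ordinal.mem_toZFSet_iff.2 ⟨0, Ordinal.omega0_pos, Ordinal.toZFSet_zero⟩

theorem omegaSet_mem_of_fixed {N : Set ZFSet.{u}} (k : ElemEmb Set.univ N) (hN : TransClass N)
    {κ : ZFSet.{u}} (hκ : κ.IsOrdinal) (hfix : ∀ α ∈ κ, k.toFun α = α) (hmem : κ ∈ k.toFun κ) :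
    omegaSet ∈ κ := by
  rcases hκ.mem_trichotomous (ZFSet.isOrdinal_toZFSet Ordinal.omega0) with h | h | h
  · exfalso
    rcases eq_empty_or_insert_of_mem_omegaSet h with rfl | ⟨m, rfl⟩
    · have h : Dfn.{u} fun _ (v : Fin 1 → ZFSet.{u}) => ∀ y ∈ v 0, y ∈ y :=
        .ball _ <| .mem _ _
      exact ZFSet.mem_irrefl _ ((k.transfer transClass_univ hN h ![∅] fun _ => trivial).1
        (fun y hy => absurd hy (ZFSet.notMem_empty y)) _ hmem)
    · have h : Dfn.{u} fun _ (v : Fin 2 → ZFSet.{u}) => ∀ y ∈ v 0, y = v 1 ∨ y ∈ v 1 :=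
        .ball _ <| .or (.eq (Fin.last 2) (Fin.castSucc 1)) (.mem (Fin.last 2) (Fin.castSucc 1))
      have hm := ZFSet.mem_insert m m
      have := (k.transfer transClass_univ hN h ![insert m m, m] fun _ => trivial).1
        (fun y hy => ZFSet.mem_insert_iff.1 hy) _ hmem
      simp only [Matrix.cons_val_one, Matrix.cons_val_fin_one, hfix m hm] at this
      rcases this with e | h
      · exact ZFSet.mem_irrefl m (by rwa [e] at hm)
      · exact ZFSet.mem_asymm h hm
  · exfalso
    have hD : Dfn.{u} fun _ (v : Fin 1 → ZFSet.{u}) =>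
        ∀ n ∈ v 0, (∀ m ∈ n, ∃ m' ∈ n, m ∈ m') → ∀ m ∈ n, m ∈ m :=
      .ball _ <| .imp (.ball (Fin.last 1) <| .bex (Fin.last 1).castSucc <| .mem _ _)
        (.ball (Fin.last 1) <| .mem _ _)
    refine ZFSet.mem_irrefl ∅ ((k.transfer transClass_univ hN hD ![κ] fun _ => trivial).1 ?_ κ hmem
      (fun m hm => ⟨insert m m, ?_, ZFSet.mem_insert m m⟩) ∅ ?_)
    · intro n hn hlim
      rcases eq_empty_or_insert_of_mem_omegaSet (h ▸ hn) with rfl | ⟨m, rfl⟩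
      · exact fun m hm => absurd hm (ZFSet.notMem_empty m)
      · obtain ⟨m', hm', hmm'⟩ := hlim m (ZFSet.mem_insert m m)
        rcases ZFSet.mem_insert_iff.1 hm' with rfl | h
        · exact absurd hmm' (ZFSet.mem_irrefl _)
        · exact absurd h (ZFSet.mem_asymm hmm')
    · subst h
      exact insert_mem_omegaSet hm
    · subst h
      exact empty_mem_omegaSet
  · exact h

/-! ### From weak covering to covering -/

/-- The infinite subsets of `lam` that include `ω` and are smaller than `κ`. -/
noncomputable def coverIndex (κ lam : ZFSet.{u}) : ZFSet.{u} :=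
  (ZFSet.powerset lam).sep fun p => omegaSet ⊆ p ∧ ∃ β ∈ κ, p.card ≤ β.card

theorem mem_coverIndex {κ lam p : ZFSet.{u}} :
    p ∈ coverIndex κ lam ↔ p ⊆ lam ∧ omegaSet ⊆ p ∧ ∃ β ∈ κ, p.card ≤ β.card := by
  rw [coverIndex, ZFSet.mem_sep, ZFSet.mem_powerset]

theorem card_omegaSet : omegaSet.{u}.card = ℵ₀ := by
  rw [omegaSet, Ordinal.card_toZFSet, Ordinal.card_omega0]

theorem exists_subset_mem {κ a b : ZFSet.{u}} (hκ : κ.IsOrdinal) (ha : a ∈ κ) (hb : b ∈ κ) :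
    ∃ c ∈ κ, a ⊆ c ∧ b ⊆ c := by
  rcases (hκ.mem ha).subset_total (hκ.mem hb) with h | h
  · exact ⟨b, hb, h, fun _ => id⟩
  · exact ⟨a, ha, fun _ => id, h⟩

theorem exists_mem_coverIndex {κ lam α s : ZFSet.{u}} (hκ : κ.IsOrdinal) (hω : omegaSet ∈ κ)
    (hωlam : omegaSet ⊆ lam) (hα : α ∈ κ) (hs : CardLtIn Set.univ s κ) :
    ∃ p ∈ coverIndex κ lam, ∀ x ∈ lam, (x ∈ s ∨ x ∈ α ∨ x = α) → x ∈ p := by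
  obtain ⟨β, hβ, hsβ⟩ := cardLtIn_univ_iff.1 hs
  obtain ⟨c, hc, hαc, hβc⟩ := exists_subset_mem hκ hα hβ
  obtain ⟨d, hd, hcd, hωd⟩ := exists_subset_mem hκ hc hω
  have hinf : ℵ₀ ≤ d.card := card_omegaSet ▸ ZFSet.card_mono hωd
  refine ⟨lam ∩ (s ∪ (insert α α ∪ omegaSet)), mem_coverIndex.2 ⟨fun x hx =>
    (ZFSet.mem_inter.1 hx).1, fun x hx => ?_, d, hd, ?_⟩, fun x hx h => ?_⟩
  · simp [hωlam hx, hx]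
  · have hs' : s.card ≤ d.card := hsβ.trans (ZFSet.card_mono fun x hx => hcd (hβc hx))
    have hα' : (insert α α : ZFSet.{u}).card ≤ d.card := ZFSet.card_insert_le.trans <|
      add_le_of_le hinf (ZFSet.card_mono fun x hx => hcd (hαc hx)) (one_le_aleph0.trans hinf)
    refine (ZFSet.card_mono fun x hx => (ZFSet.mem_inter.1 hx).2).trans <|
      ZFSet.card_union_le.trans <| add_le_of_le hinf hs' <|
      ZFSet.card_union_le.trans <| add_le_of_le hinf hα' (ZFSet.card_mono hωd)
  · simp only [ZFSet.mem_inter, ZFSet.mem_union, ZFSet.mem_insert_iff]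
    tauto

theorem Dfn.collapse_iff {H N : Set ZFSet.{u}} (hN : TransClass N) (hH : IsElemSub H N) {n : ℕ}
    {R : Set ZFSet.{u} → (Fin n → ZFSet.{u}) → Prop} (hR : Dfn R) (v : Fin n → ZFSet.{u})
    (hv : ∀ i, v i ∈ H) : R (collapse H '' H) (fun i => collapse H (v i)) ↔ R N v := by
  obtain ⟨φ, hφ⟩ := hR
  rw [← hφ N hN v fun i => hH.1 (hv i), ← realize_collapse_iff hN hH φ v hv,
    hφ _ (transClass_collapse H) _ fun i => ⟨_, hv i, rfl⟩]

/-- An embedding with the weak `lam`-covering property factors through one with the full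
`lam`-covering property that has the same values below `lam`. -/
theorem exists_coversIn_of_wCovers {N : Set ZFSet.{u}} (hN : TransClass N)
    (k : ElemEmb Set.univ N) {κ lam : ZFSet.{u}} (hκ : κ.IsOrdinal)
    (hfix : ∀ α ∈ κ, k.toFun α = α) (hκlam : oLe κ lam) (hlam : lam ∈ k.toFun κ)
    (hcov : WCovers N k.toFun κ lam) :
    ∃ N' : Set ZFSet.{u}, TransClass N' ∧ ∃ k' : ElemEmb Set.univ N',
      (∀ α ∈ κ, k'.toFun α = α) ∧ lam ∈ k'.toFun κ ∧ CoversIn Set.univ N' k'.toFun κ lam ∧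
        ∀ A, ∀ ξ ∈ lam, (ξ ∈ k'.toFun A ↔ ξ ∈ k.toFun A) := by
  have hkκ := isOrdinal_apply k hN hκ
  have hlamO := hkκ.mem hlam
  have hκsub : κ ⊆ lam := by
    rcases hκlam with h | rfl
    exacts [hlamO.subset_of_mem h, fun _ => id]
  have hκmem : κ ∈ k.toFun κ := by
    rcases hκlam with h | rfl
    exacts [hkκ.mem_trans h hlam, hlam]
  have hω := omegaSet_mem_of_fixed k hN hκ hfix hκmem
  have hωlam : omegaSet ⊆ lam := hlamO.subset_of_mem (hκsub hω)
  have hlam' : lam ∈ k.toFun lam := (k.subset_iff hN κ lam).1 hκsub _ hlam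
  have hklam := isOrdinal_apply k hN hlamO
  obtain ⟨s, hsN, hs, hscard⟩ := hcov
  set D := coverIndex κ lam
  have hdfn : Dfn.{u} fun C (v : Fin 3 → ZFSet.{u}) => ∀ α ∈ v 0, ∀ s ∈ C, CardLtIn C s (v 0) →
      ∃ p ∈ v 1, ∀ x ∈ v 2, (x ∈ s ∨ x ∈ α ∨ x = α) → x ∈ p :=
    .ball _ <| .all <| .imp (.cardLtIn (Fin.last 4) 0) <| .bex 1 <| .ball 2 <|
      .imp (.or (.mem (Fin.last 6) 4) <| .or (.mem (Fin.last 6) 3) (.eq (Fin.last 6) 3))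
        (.mem (Fin.last 6) 5)
  obtain ⟨t, htD, ht⟩ := (k.transfer transClass_univ hN hdfn ![κ, D, lam] fun _ => trivial).1
    (fun α hα s _ hs => exists_mem_coverIndex hκ hω hωlam hα hs) lam hlam s hsN hscard
  have hkt : ∀ α ∈ lam, k.toFun α ∈ t := fun α hα =>
    ht _ ((k.mem_iff hN α lam).1 hα) (.inl (hs α hα))
  have hlt : ∀ x ∈ (insert lam lam : ZFSet.{u}), x ∈ t := fun x hx => by
    rcases ZFSet.mem_insert_iff.1 hx with rfl | hx
    · exact ht _ hlam' (.inr (.inr rfl))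
    · exact ht _ (hklam.mem_trans hx hlam') (.inr (.inl hx))
  have hD : ∀ p ∈ D, ℵ₀ ≤ p.card := fun p hp =>
    card_omegaSet ▸ ZFSet.card_mono (mem_coverIndex.1 hp).2.1
  set H := hull k D t
  have hH : IsElemSub H N := isElemSub_hull hN htD hD
  have hkH : ∀ y, k.toFun y ∈ H := apply_mem_hull hN htD hD
  have hlH : ∀ x ∈ (insert lam lam : ZFSet.{u}), x ∈ H := fun x hx =>
    mem_hull_of_mem hN htD (hlt x hx)
  have hcol : ∀ x ∈ (insert lam lam : ZFSet.{u}), collapse H x = x := fun x hx =>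
    collapse_eq_self (ZFSet.isOrdinal_succ hlamO).isTransitive hlH hx
  have hmem : ∀ x ∈ (insert lam lam : ZFSet.{u}), ∀ y, x ∈ collapse H y ↔ x ∈ y :=
    fun x hx y => by
      conv_lhs => rw [← hcol x hx]
      exact collapse_mem_iff hN hH (hlH x hx)
  have hins : ∀ x ∈ lam, x ∈ (insert lam lam : ZFSet.{u}) := fun x hx =>
    ZFSet.mem_insert_of_mem _ hx
  refine ⟨collapse H '' H, transClass_collapse H, ElemEmb.collapseComp hN hH k fun x _ => hkH x,
    fun α hα => ?_, (hmem _ (ZFSet.mem_insert _ _) _).2 hlam, ?_, fun A ξ hξ =>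
      hmem ξ (hins ξ hξ) _⟩
  · change collapse H (k.toFun α) = α
    rw [hfix α hα, hcol α (hins α (hκsub hα))]
  · rintro X - hX ⟨f, -, hf⟩
    obtain ⟨g, hg, hinj⟩ := exists_injection_iff.1 ⟨f, hf⟩
    have hx : ∀ α : lam, ∃ y ∈ H, ∀ z ∈ X, g z = α → collapse H y = z := by
      intro α
      by_cases h : ∃ z ∈ X, g z = α
      · obtain ⟨z, hz, e⟩ := h
        obtain ⟨y, hy, rfl⟩ := hX hz
        exact ⟨y, hy, fun z' hz' e' => hinj _ hz z' hz' (e.trans e'.symm)⟩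
      · exact ⟨_, hkH ∅, fun z hz e => absurd ⟨z, hz, e⟩ h⟩
    choose x hxH hx using hx
    obtain ⟨Z, hZH, hxZ, hZ⟩ := exists_cover_mem_hull hN htD hD
      (fun p hp => (mem_coverIndex.1 hp).1) (fun p hp => (mem_coverIndex.1 hp).2.2) hkt x hxH
    refine ⟨collapse H Z, ⟨Z, hZH, rfl⟩, fun z hz => ?_, ?_⟩
    · rw [← hx ⟨g z, hg z hz⟩ z hz rfl]
      exact (collapse_mem_iff hN hH (hxH _)).2 (hxZ _)
    · exact (Dfn.collapse_iff hN hH (Dfn.cardLtIn 0 1) ![Z, k.toFun κ] (by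
        intro i
        fin_cases i
        exacts [hZH, hkH κ])).2 hZ

/-- **Corollary.**  If `κ` is `lam`-strong for a set of ordinals `A` and
`lam`-strongly compact, then `κ` is `lam`-strongly compact for `A`. -/
theorem strongly_compact_for_A (κ lam A : ZFSet) (hκ : IsCard κ) (hκlam : oLe κ lam)
    (hA : ∀ x ∈ A, IsOrd x)
    (hstr : LamStrongFor κ lam A) (hsc : LamSC κ lam) :
    LamSCFor κ lam A := by
  obtain ⟨M, -, hM, j, hj, hlamj, -, hAj⟩ := hstr
  obtain ⟨N, -, hN, i, hi, hlami, s, hsN, hs, hscard⟩ := hsc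
  have hκO : κ.IsOrdinal := isOrd_iff.1 hκ.1
  have hN' := transClass_imageClass j hM hN
  have hiκ := isOrdinal_apply i hN hκO
  have hjκ := isOrdinal_apply j hM hκO
  have hκi : κ ∈ i.toFun κ := by
    rcases hκlam with h | rfl
    exacts [hiκ.mem_trans h hlami, hlami]
  have hjk : j.toFun κ ∈ j.toFun (i.toFun κ) := (j.mem_iff hM _ _).1 hκi
  obtain ⟨N', hN'', k, hfix, hlam, hcov, hA'⟩ := exists_coversIn_of_wCovers hN'
    ((j.restrict hM N).comp i) (κ := κ) (lam := lam) hκO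
    (fun α hα => (congrArg j.toFun (hi.2.2 α hα)).trans (hj.2.2 α hα)) hκlam
    ((isOrdinal_apply j hM hiκ).mem_trans hlamj hjk)
    ⟨j.toFun s, (j.restrict hM N).maps s hsN, fun α hα => (j.mem_iff hM _ _).1 (hs α hα),
      ((j.restrict hM N).transfer hN hN' (Dfn.cardLtIn 0 1) ![s, i.toFun κ] (by
        intro a
        fin_cases a
        exacts [hsN, i.maps κ trivial])).1 hscard⟩
  refine ⟨N', fun _ _ => trivial, hN'', k, ⟨hκ.1, fun e => ?_, hfix⟩, hlam, hcov,
    fun ξ hξ => ?_⟩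
  · rw [e] at hlam
    rcases hκlam with h | rfl
    exacts [ZFSet.mem_asymm h hlam, ZFSet.mem_irrefl _ hlam]
  · have hdfn : Dfn fun _ (v : Fin 3 → ZFSet) => ∀ x ∈ v 0, (x ∈ v 1 ↔ x ∈ v 2) :=
      .ball _ <| .iff (.mem (Fin.last 3) 1) (.mem (Fin.last 3) 2)
    have h := (j.transfer transClass_univ hM hdfn ![κ, A, i.toFun A] fun _ => trivial).1
      (fun x hx => by
        have := i.mem_iff hN x A
        rwa [hi.2.2 x hx] at this) ξ (hjκ.mem_trans hξ hlamj)
    exact (hAj ξ trivial (ZFSet.rank_lt_of_mem hξ)).trans (h.trans (hA' A ξ hξ).symm)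

end WSC
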